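/- arXiv:1305.1073 — 2 statements merged into one kernel-verified Lean document; each statement's English description precedes it below -/
import Mathlib

section
/- Let r ≥ 2 and let P be a hereditary property of r-graphs containing graphs of arbitrarily large order. Then for every real α > 1, λ^(α)(P) = π(P). -/
/-!
Common definitions: `r`-uniform hypergraphs on vertex set `Fin n`, the polyform,
the parameter `λ^(α)`, degrees, properties of `r`-graphs, blow-ups, extremal
numbers and chromatic numbers.
-/

open Finset

/-- An `r`-uniform hypergraph on the vertex set `Fin n`. -/
structure HGraph (r n : ℕ) where
  edges : Finset (Finset (Fin n))
  uniform : ∀ e ∈ edges, e.card = r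

namespace HGraph

/-- The polyform `P_G(x) = r! ∑_{e ∈ E(G)} ∏_{i ∈ e} x_i`. -/
noncomputable def polyform {r n : ℕ} (G : HGraph r n) (x : Fin n → ℝ) : ℝ :=
  (r.factorial : ℝ) * ∑ e ∈ G.edges, ∏ i ∈ e, x i

/-- `λ^(α)(G)`: the maximum of the polyform over the unit sphere of `ℓ^α`. -/
noncomputable def lam {r n : ℕ} (α : ℝ) (G : HGraph r n) : ℝ :=
  sSup {y : ℝ | ∃ x : Fin n → ℝ, (∑ i, |x i| ^ α) = 1 ∧ y = G.polyform x}

/-- The degree of a vertex: the number of edges containing it. -/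
def degree {r n : ℕ} (G : HGraph r n) (v : Fin n) : ℕ :=
  (G.edges.filter (fun e => v ∈ e)).card

/-- Maximum degree `Δ(G)`. -/
def maxDeg {r n : ℕ} (G : HGraph r n) : ℕ :=
  Finset.univ.sup G.degree

/-- Minimum degree `δ(G)`. -/
noncomputable def minDeg {r n : ℕ} (G : HGraph r n) : ℕ :=
  sInf (Set.range G.degree)

/-- `G` is regular if all vertices have equal degrees. -/
def Regular {r n : ℕ} (G : HGraph r n) : Prop :=
  ∀ u v : Fin n, G.degree u = G.degree v

/-- The induced subgraph of `G` along the embedding `f`. -/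
def induce {r n m : ℕ} (G : HGraph r n) (f : Fin m ↪ Fin n) : HGraph r m where
  edges := Finset.univ.filter (fun e : Finset (Fin m) => e.map f ∈ G.edges)
  uniform := by
    intro e he
    rw [Finset.mem_filter] at he
    have h2 := G.uniform _ he.2
    rwa [Finset.card_map] at h2

/-- A property of `r`-graphs: a family closed under isomorphism (relabeling). -/
def IsProperty {r : ℕ} (P : ∀ n, Set (HGraph r n)) : Prop :=
  ∀ n : ℕ, ∀ σ : Equiv.Perm (Fin n), ∀ G ∈ P n, G.induce σ.toEmbedding ∈ P n

/-- A hereditary property: closed under taking induced subgraphs. -/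
def Hereditary {r : ℕ} (P : ∀ n, Set (HGraph r n)) : Prop :=
  ∀ n m : ℕ, ∀ f : Fin m ↪ Fin n, ∀ G ∈ P n, G.induce f ∈ P m

/-- A monotone property: closed under taking subgraphs. -/
def MonotoneProp {r : ℕ} (P : ∀ n, Set (HGraph r n)) : Prop :=
  ∀ n m : ℕ, ∀ f : Fin m ↪ Fin n, ∀ G ∈ P n, ∀ H : HGraph r m,
    (∀ e ∈ H.edges, e.map f ∈ G.edges) → H ∈ P m

/-- `B`, together with the projection `φ : V(B) → V(G)`, is (a copy of) the blow-up
`G(k 1, …, k n)` of `G`: the fiber over a vertex `i` of `G` has `k i` vertices, and the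
edges of `B` are exactly the transversals of the classes corresponding to edges of `G`. -/
def IsBlowup {r n N : ℕ} (G : HGraph r n) (k : Fin n → ℕ)
    (B : HGraph r N) (φ : Fin N → Fin n) : Prop :=
  (∀ i : Fin n, (Finset.univ.filter (fun v => φ v = i)).card = k i) ∧
  ∀ s : Finset (Fin N), s ∈ B.edges ↔ (Set.InjOn φ ↑s ∧ s.image φ ∈ G.edges)

/-- A multiplicative property: contains all blow-ups of all of its members. -/
def MultiplicativeProp {r : ℕ} (P : ∀ n, Set (HGraph r n)) : Prop :=
  ∀ n : ℕ, ∀ G ∈ P n, ∀ k : Fin n → ℕ, (∀ i, 0 < k i) →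
    ∀ N : ℕ, ∀ B : HGraph r N, ∀ φ : Fin N → Fin n, IsBlowup G k B φ → B ∈ P N

/-- The extremal number `ex(P, n)`: the maximum number of edges of a member of `P`
of order `n`. -/
noncomputable def exP {r : ℕ} (P : ∀ n, Set (HGraph r n)) (n : ℕ) : ℕ :=
  sSup {m : ℕ | ∃ G ∈ P n, G.edges.card = m}

/-- `λ^(α)(P, n)`: the maximum of `λ^(α)(G)` over members `G` of `P` of order `n`. -/
noncomputable def lamP {r : ℕ} (α : ℝ) (P : ∀ n, Set (HGraph r n)) (n : ℕ) : ℝ :=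
  sSup {y : ℝ | ∃ G ∈ P n, y = lam α G}

/-- The chromatic number: the least `k` such that the vertices can be `k`-colored
with no monochromatic edge (i.e. partitioned into `k` edgeless sets). -/
noncomputable def chrom {r n : ℕ} (G : HGraph r n) : ℕ :=
  sInf {k : ℕ | ∃ c : Fin n → Fin k, ∀ e ∈ G.edges, ¬ ∀ u ∈ e, ∀ w ∈ e, c u = c w}

/-- The weak chromatic number: the least `k` such that the vertices can be `k`-colored
with every edge getting `r` distinct colors (every class meets every edge in ≤ 1 vertex). -/
noncomputable def wchrom {r n : ℕ} (G : HGraph r n) : ℕ :=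
  sInf {k : ℕ | ∃ c : Fin n → Fin k, ∀ e ∈ G.edges, Set.InjOn c ↑e}

/-- `Mon(H)`: the (monotone, hereditary) property of all `r`-graphs containing no
subgraph isomorphic to `H`. -/
def MonP {r h : ℕ} (H : HGraph r h) : ∀ n, Set (HGraph r n) :=
  fun n => {G | ¬ ∃ f : Fin h ↪ Fin n, ∀ e ∈ H.edges, e.map f ∈ G.edges}

end HGraph

namespace HGraph

lemma sum_prod_pi_eq_pow {ι κ : Type*} [Fintype ι] [DecidableEq ι] [Fintype κ] (x : κ → ℝ) :
    ∑ f : ι → κ, ∏ i, x (f i) = (∑ j, x j) ^ Fintype.card ι := by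
  rw [← Fintype.prod_sum (fun (_ : ι) j => x j)]
  simp

/-- The maps from a set of size `r` onto a fixed set `E` of size `r` carry at least
`r!` times the weight of `E`. -/
lemma factorial_mul_prod_le_sum_image_eq {ι κ : Type*} [Fintype ι] [DecidableEq ι] [Fintype κ]
    [DecidableEq κ] (x : κ → ℝ) (E : Finset κ) (hx : ∀ i, 0 ≤ x i)
    (hE : E.card = Fintype.card ι) :
    ((Fintype.card ι).factorial : ℝ) * ∏ i ∈ E, x i ≤
      ∑ g : ι → κ with univ.image g = E, ∏ i, x (g i) := by
  have e₀ : ι ≃ E := Fintype.equivOfCardEq (by simp [hE])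
  have himage (σ : ι ≃ E) : univ.image (fun i => (σ i : κ)) = E := by
    ext j
    simp only [mem_image, mem_univ, true_and]
    exact ⟨fun ⟨i, hi⟩ => hi ▸ (σ i).2, fun hj => ⟨σ.symm ⟨j, hj⟩, by simp⟩⟩
  let s : Finset (ι → κ) := univ.image fun σ : ι ≃ E => fun i => (σ i : κ)
  have hs : s.card = (Fintype.card ι).factorial := by
    rw [← Fintype.card_equiv e₀, ← Finset.card_univ]
    refine Finset.card_image_of_injective _ fun σ τ h => ?_
    ext i
    exact congrFun h i
  have hsum : ∑ g ∈ s, ∏ i, x (g i) = ((Fintype.card ι).factorial : ℝ) * ∏ i ∈ E, x i := by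
    rw [← hs, ← nsmul_eq_mul, ← Finset.sum_const]
    refine Finset.sum_congr rfl fun g hg => ?_
    obtain ⟨σ, -, rfl⟩ := Finset.mem_image.1 hg
    rw [← Finset.prod_coe_sort E x]
    exact Equiv.prod_comp σ (fun j : E => x j)
  rw [← hsum]
  refine Finset.sum_le_sum_of_subset_of_nonneg (fun g hg => ?_)
    fun g _ _ => Finset.prod_nonneg fun i _ => hx _
  obtain ⟨σ, -, rfl⟩ := Finset.mem_image.1 hg
  simpa using himage σ

lemma polyform_mul_pow_le_sum {r n m : ℕ} (G : HGraph r n) (x : Fin n → ℝ) (hx : ∀ i, 0 ≤ x i)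
    (e : Finset (Fin m)) (he : e.card = r) :
    G.polyform x * (∑ i, x i) ^ (m - r) ≤
      ∑ f : Fin m → Fin n with e.image f ∈ G.edges, ∏ i, x (f i) := by
  have hS : 0 ≤ ∑ i, x i := Finset.sum_nonneg fun i _ => hx i
  have hcard : Fintype.card {i // i ∈ e} = r := by simp [he]
  have hcard' : Fintype.card {i // i ∉ e} = m - r := by
    rw [Fintype.card_subtype_compl, hcard, Fintype.card_fin]
  have hsplit : ∑ f : Fin m → Fin n with e.image f ∈ G.edges, ∏ i, x (f i) =
      (∑ g : {i // i ∈ e} → Fin n with univ.image g ∈ G.edges, ∏ i, x (g i)) *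
        (∑ i, x i) ^ (m - r) := by
    rw [← hcard', ← sum_prod_pi_eq_pow, Finset.sum_filter, Finset.sum_filter,
      Fintype.sum_mul_sum, ← Fintype.sum_prod_type']
    refine Fintype.sum_equiv (Equiv.piEquivPiSubtypeProd (· ∈ e) fun _ => Fin n) _ _ fun f => ?_
    have himage : (univ : Finset {i // i ∈ e}).image (fun i => f i.1) = e.image f := by
      ext j; simp
    have hprod : ∏ i, x (f i) = (∏ i : {i // i ∈ e}, x (f i)) * ∏ i : {i // i ∉ e}, x (f i) := by
      rw [← Fintype.prod_subtype_mul_prod_subtype (· ∈ e) fun i => x (f i)]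
      congr!
    simp only [Equiv.piEquivPiSubtypeProd, Equiv.coe_fn_mk, himage, hprod, ite_mul, zero_mul]
  rw [hsplit]
  refine mul_le_mul_of_nonneg_right ?_ (pow_nonneg hS _)
  have hfib : ∑ g : {i // i ∈ e} → Fin n with univ.image g ∈ G.edges, ∏ i, x (g i) =
      ∑ E ∈ G.edges, ∑ g : {i // i ∈ e} → Fin n with univ.image g = E, ∏ i, x (g i) := by
    rw [← Finset.sum_fiberwise_of_maps_to (t := G.edges) (g := fun g => univ.image g)
      (fun g hg => (Finset.mem_filter.1 hg).2)]
    refine Finset.sum_congr rfl fun E hE => Finset.sum_congr ?_ fun _ _ => rfl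
    ext g
    simp only [mem_filter, mem_univ, true_and]
    exact ⟨fun h => h.2, fun h => ⟨h ▸ hE, h⟩⟩
  rw [hfib, polyform, Finset.mul_sum]
  refine Finset.sum_le_sum fun E hE => ?_
  have := factorial_mul_prod_le_sum_image_eq (ι := {i // i ∈ e}) x E hx
    (by rw [hcard, G.uniform E hE])
  rwa [hcard] at this

lemma sum_prod_collision_le {n k : ℕ} (x : Fin n → ℝ) (hx : ∀ i, 0 ≤ x i) (hx1 : ∀ i, x i ≤ 1)
    {a b : Fin (k + 1)} (hab : a ≠ b) :
    ∑ f : Fin (k + 1) → Fin n with f a = f b, ∏ i, x (f i) ≤ (∑ i, x i) ^ k := by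
  obtain ⟨a', rfl⟩ := Fin.exists_succAbove_eq hab
  have h := sum_prod_pi_eq_pow (ι := Fin k) x
  rw [Fintype.card_fin] at h
  rw [Finset.sum_filter, ← h, ← (Fin.insertNthEquiv (fun _ => Fin n) b).sum_comp,
    Fintype.sum_prod_type_right]
  refine Finset.sum_le_sum fun g _ => ?_
  simp only [Fin.insertNthEquiv_apply, Fin.insertNth_apply_succAbove, Fin.insertNth_apply_same,
    Fin.prod_univ_succAbove _ b, Finset.sum_ite_eq, mem_univ, if_true]
  exact mul_le_of_le_one_left (Finset.prod_nonneg fun i _ => hx _) (hx1 _)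

lemma sum_prod_not_injective_le {n k : ℕ} (x : Fin n → ℝ) (hx : ∀ i, 0 ≤ x i)
    (hx1 : ∀ i, x i ≤ 1) :
    ∑ f : Fin (k + 1) → Fin n with ¬ Function.Injective f, ∏ i, x (f i) ≤
      ((k : ℝ) + 1) ^ 2 * (∑ i, x i) ^ k := by
  have hw (f : Fin (k + 1) → Fin n) : 0 ≤ ∏ i, x (f i) := Finset.prod_nonneg fun i _ => hx _
  calc ∑ f : Fin (k + 1) → Fin n with ¬ Function.Injective f, ∏ i, x (f i)
      ≤ ∑ f : Fin (k + 1) → Fin n, ∑ p : Fin (k + 1) × Fin (k + 1),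
          if p.1 ≠ p.2 ∧ f p.1 = f p.2 then ∏ i, x (f i) else 0 := by
        rw [Finset.sum_filter]
        refine Finset.sum_le_sum fun f _ => ?_
        have hnn : ∀ p ∈ (univ : Finset (Fin (k + 1) × Fin (k + 1))),
            0 ≤ if p.1 ≠ p.2 ∧ f p.1 = f p.2 then ∏ i, x (f i) else 0 := fun p _ => by
          split_ifs
          exacts [hw f, le_rfl]
        split_ifs with hf
        · exact Finset.sum_nonneg hnn
        · obtain ⟨a, b, h, hab⟩ := Function.not_injective_iff.1 hf
          refine le_trans ?_ (Finset.single_le_sum hnn (mem_univ (a, b)))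
          simp [h, hab]
    _ = ∑ p : Fin (k + 1) × Fin (k + 1), ∑ f : Fin (k + 1) → Fin n,
          if p.1 ≠ p.2 ∧ f p.1 = f p.2 then ∏ i, x (f i) else 0 := Finset.sum_comm
    _ ≤ ∑ _p : Fin (k + 1) × Fin (k + 1), (∑ i, x i) ^ k := by
        refine Finset.sum_le_sum fun p _ => ?_
        by_cases hp : p.1 = p.2
        · simp only [hp, ne_eq, not_true_eq_false, false_and, if_false, Finset.sum_const_zero]
          exact pow_nonneg (Finset.sum_nonneg fun i _ => hx i) _
        · simp only [ne_eq, hp, not_false_eq_true, true_and]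
          rw [← Finset.sum_filter]
          exact sum_prod_collision_le x hx hx1 hp
    _ = ((k : ℝ) + 1) ^ 2 * (∑ i, x i) ^ k := by
        simp [sq]

/-- Sampling `k + 1` vertices independently with weights `x` bounds the polyform of `G` in
terms of the edge counts of its induced subgraphs of order `k + 1`. -/
lemma choose_mul_polyform_le {r n k : ℕ} (G : HGraph r n) (x : Fin n → ℝ)
    (hx : ∀ i, 0 ≤ x i) (hx1 : ∀ i, x i ≤ 1) (M : ℕ)
    (hM : ∀ f : Fin (k + 1) ↪ Fin n, (G.induce f).edges.card ≤ M) :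
    ((k + 1).choose r : ℝ) * (G.polyform x * (∑ i, x i) ^ (k + 1 - r)) ≤
      M * (∑ i, x i) ^ (k + 1) +
        ((k + 1).choose r : ℝ) * (((k : ℝ) + 1) ^ 2 * (∑ i, x i) ^ k) := by
  have hw (f : Fin (k + 1) → Fin n) : 0 ≤ ∏ i, x (f i) := Finset.prod_nonneg fun i _ => hx _
  let c (f : Fin (k + 1) → Fin n) : ℕ :=
    ((powersetCard r (univ : Finset (Fin (k + 1)))).filter fun e => e.image f ∈ G.edges).card
  have hc (f) : c f ≤ (k + 1).choose r := by
    refine (Finset.card_filter_le _ _).trans ?_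
    simp
  have hcinj (f) (hf : Function.Injective f) : c f ≤ M := by
    refine le_trans (Finset.card_le_card fun e he => ?_) (hM ⟨f, hf⟩)
    simpa [induce, Finset.map_eq_image] using (Finset.mem_filter.1 he).2
  calc ((k + 1).choose r : ℝ) * (G.polyform x * (∑ i, x i) ^ (k + 1 - r))
      = ∑ e ∈ powersetCard r (univ : Finset (Fin (k + 1))),
          G.polyform x * (∑ i, x i) ^ (k + 1 - r) := by simp
    _ ≤ ∑ e ∈ powersetCard r (univ : Finset (Fin (k + 1))),
          ∑ f : Fin (k + 1) → Fin n with e.image f ∈ G.edges, ∏ i, x (f i) :=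
        Finset.sum_le_sum fun e he =>
          polyform_mul_pow_le_sum G x hx e (Finset.mem_powersetCard.1 he).2
    _ = ∑ f : Fin (k + 1) → Fin n, c f * ∏ i, x (f i) := by
        simp_rw [Finset.sum_filter]
        rw [Finset.sum_comm]
        refine Finset.sum_congr rfl fun f _ => ?_
        rw [← Finset.sum_filter, Finset.sum_const, nsmul_eq_mul]
    _ ≤ ∑ f : Fin (k + 1) → Fin n, (M * ∏ i, x (f i) + ((k + 1).choose r : ℝ) *
          if ¬ Function.Injective f then ∏ i, x (f i) else 0) := by
        refine Finset.sum_le_sum fun f _ => ?_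
        by_cases hf : Function.Injective f
        · simpa [hf] using mul_le_mul_of_nonneg_right (Nat.cast_le.2 (hcinj f hf)) (hw f)
        · simp only [hf, not_false_eq_true, if_true]
          exact (mul_le_mul_of_nonneg_right (Nat.cast_le.2 (hc f)) (hw f)).trans
            (le_add_of_nonneg_left (mul_nonneg (Nat.cast_nonneg _) (hw f)))
    _ ≤ _ := by
        rw [Finset.sum_add_distrib, ← Finset.mul_sum, ← Finset.mul_sum, ← Finset.sum_filter,
          sum_prod_pi_eq_pow, Fintype.card_fin]
        gcongr
        exact sum_prod_not_injective_le x hx hx1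

lemma polyform_le {r n k : ℕ} (hr : 1 ≤ r) (hrk : r ≤ k + 1) (G : HGraph r n) (x : Fin n → ℝ)
    (hx : ∀ i, 0 ≤ x i) (hx1 : ∀ i, x i ≤ 1) (hS : 0 < ∑ i, x i) (M : ℕ)
    (hM : ∀ f : Fin (k + 1) ↪ Fin n, (G.induce f).edges.card ≤ M) :
    G.polyform x ≤ (M : ℝ) / ((k + 1).choose r : ℝ) * (∑ i, x i) ^ r +
      ((k : ℝ) + 1) ^ 2 * (∑ i, x i) ^ (r - 1) := by
  have h := choose_mul_polyform_le G x hx hx1 M hM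
  set S := ∑ i, x i
  have hC : (0 : ℝ) < ((k + 1).choose r : ℝ) := Nat.cast_pos.2 (Nat.choose_pos hrk)
  have hP : 0 < S ^ (k + 1 - r) := pow_pos hS _
  have h1 : S ^ (k + 1) = S ^ (k + 1 - r) * S ^ r := by rw [← pow_add]; congr 1; omega
  have h2 : S ^ k = S ^ (k + 1 - r) * S ^ (r - 1) := by rw [← pow_add]; congr 1; omega
  rw [h1, h2] at h
  refine le_of_mul_le_mul_left (h.trans_eq' ?_ |>.trans_eq ?_) (mul_pos hC hP)
  · ring
  · field_simp

lemma abs_le_one_of_sum_rpow_eq_one {ι : Type*} [Fintype ι] {α : ℝ} (hα : 0 < α) {x : ι → ℝ}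
    (hx : ∑ i, |x i| ^ α = 1) (i : ι) : |x i| ≤ 1 := by
  have h : |x i| ^ α ≤ 1 := hx ▸ Finset.single_le_sum
    (f := fun i => |x i| ^ α) (fun j _ => Real.rpow_nonneg (abs_nonneg _) _) (mem_univ i)
  by_contra! h1
  exact absurd (Real.one_lt_rpow h1 hα) (not_lt.2 h)

lemma polyform_le_of_sum_rpow_eq_one {r n k : ℕ} (hr : 1 ≤ r) (hrk : r ≤ k + 1)
    (G : HGraph r n) {α : ℝ} (hα : 1 ≤ α) {x : Fin n → ℝ} (hx : ∑ i, |x i| ^ α = 1) (M : ℕ)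
    (hM : ∀ f : Fin (k + 1) ↪ Fin n, (G.induce f).edges.card ≤ M) :
    G.polyform x ≤ (M : ℝ) / ((k + 1).choose r : ℝ) * ((n : ℝ) ^ (1 - 1 / α)) ^ r +
      ((k : ℝ) + 1) ^ 2 * ((n : ℝ) ^ (1 - 1 / α)) ^ (r - 1) := by
  have hα0 : 0 < α := by linarith
  have hx1 := abs_le_one_of_sum_rpow_eq_one hα0 hx
  have hS1 : 1 ≤ ∑ i, |x i| := by
    rw [← hx]
    refine Finset.sum_le_sum fun i _ => ?_
    simpa using Real.rpow_le_rpow_of_exponent_ge' (abs_nonneg _) (hx1 i) zero_le_one hα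
  have hSn : ∑ i, |x i| ≤ (n : ℝ) ^ (1 - 1 / α) := by
    have h := Real.rpow_sum_le_const_mul_sum_rpow univ x hα
    rw [hx, mul_one, Finset.card_univ, Fintype.card_fin] at h
    have h' := Real.rpow_le_rpow (by positivity) h (one_div_nonneg.2 hα0.le)
    rw [← Real.rpow_mul (by positivity), ← Real.rpow_mul (by positivity),
      mul_one_div_cancel hα0.ne', Real.rpow_one] at h'
    convert! h' using 2
    field_simp
  have habs : G.polyform x ≤ G.polyform fun i => |x i| := by
    unfold polyform
    refine mul_le_mul_of_nonneg_left (Finset.sum_le_sum fun e _ => ?_) (Nat.cast_nonneg _)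
    rw [← Finset.abs_prod]
    exact le_abs_self _
  refine habs.trans ((polyform_le hr hrk G _ (fun i => abs_nonneg _) hx1
    (by linarith) M hM).trans ?_)
  gcongr

lemma card_edges_le_choose {r n : ℕ} (G : HGraph r n) : G.edges.card ≤ n.choose r := by
  refine (Finset.card_le_card (t := powersetCard r univ) fun e he => ?_).trans_eq (by simp)
  simpa using G.uniform e he

lemma bddAbove_card_edges {r : ℕ} (P : ∀ n, Set (HGraph r n)) (n : ℕ) :
    BddAbove {m : ℕ | ∃ G ∈ P n, G.edges.card = m} :=
  ⟨n.choose r, by rintro _ ⟨G, -, rfl⟩; exact G.card_edges_le_choose⟩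

lemma card_edges_le_exP {r n : ℕ} {P : ∀ n, Set (HGraph r n)} {G : HGraph r n} (hG : G ∈ P n) :
    G.edges.card ≤ exP P n :=
  le_csSup (bddAbove_card_edges P n) ⟨G, hG, rfl⟩

lemma exists_card_edges_eq_exP {r n : ℕ} {P : ∀ n, Set (HGraph r n)} (hP : (P n).Nonempty) :
    ∃ G ∈ P n, G.edges.card = exP P n := by
  obtain ⟨G, hG⟩ := hP
  have hne : {m : ℕ | ∃ G ∈ P n, G.edges.card = m}.Nonempty := ⟨_, G, hG, rfl⟩
  exact Nat.sSup_mem hne (bddAbove_card_edges P n)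

section Limits

variable {r n : ℕ} {α : ℝ}

lemma sum_abs_const_rpow (hα : 0 < α) (hn : 0 < n) :
    ∑ _i : Fin n, |(n : ℝ) ^ (-(1 / α))| ^ α = 1 := by
  have hn' : (0 : ℝ) < n := Nat.cast_pos.2 hn
  rw [abs_of_pos (Real.rpow_pos_of_pos hn' _), ← Real.rpow_mul hn'.le, Finset.sum_const,
    Finset.card_univ, Fintype.card_fin, nsmul_eq_mul, neg_mul, one_div_mul_cancel hα.ne',
    Real.rpow_neg_one, mul_inv_cancel₀ hn'.ne']

lemma lam_le (hr : 1 ≤ r) {k : ℕ} (hrk : r ≤ k + 1) (hα : 1 ≤ α) (hn : 0 < n)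
    {P : ∀ n, Set (HGraph r n)} (hP : Hereditary P) {G : HGraph r n} (hG : G ∈ P n) :
    lam α G ≤ (exP P (k + 1) : ℝ) / ((k + 1).choose r : ℝ) * ((n : ℝ) ^ (1 - 1 / α)) ^ r +
      ((k : ℝ) + 1) ^ 2 * ((n : ℝ) ^ (1 - 1 / α)) ^ (r - 1) := by
  refine csSup_le ⟨_, _, sum_abs_const_rpow (by linarith) hn, rfl⟩ ?_
  rintro _ ⟨x, hx, rfl⟩
  exact polyform_le_of_sum_rpow_eq_one hr hrk G hα hx _ fun f =>
    card_edges_le_exP (hP n (k + 1) f G hG)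

lemma bddAbove_polyform (hα : 0 < α) (G : HGraph r n) :
    BddAbove {y : ℝ | ∃ x : Fin n → ℝ, (∑ i, |x i| ^ α) = 1 ∧ y = G.polyform x} := by
  refine ⟨r.factorial * ∑ e ∈ G.edges, 1, ?_⟩
  rintro _ ⟨x, hx, rfl⟩
  unfold polyform
  gcongr with e he
  refine (le_abs_self _).trans ?_
  rw [Finset.abs_prod]
  exact Finset.prod_le_one (fun i _ => abs_nonneg _)
    fun i _ => abs_le_one_of_sum_rpow_eq_one hα hx i

lemma factorial_mul_card_edges_le_lam (hα : 0 < α) (hn : 0 < n) (G : HGraph r n) :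
    r.factorial * (G.edges.card : ℝ) * ((n : ℝ) ^ (-(1 / α))) ^ r ≤ lam α G := by
  refine le_csSup (bddAbove_polyform hα G) ⟨_, sum_abs_const_rpow hα hn, ?_⟩
  have h : ∑ e ∈ G.edges, ∏ i ∈ e, (n : ℝ) ^ (-(1 / α)) =
      ∑ e ∈ G.edges, ((n : ℝ) ^ (-(1 / α))) ^ r :=
    Finset.sum_congr rfl fun e he => by rw [Finset.prod_const, G.uniform e he]
  rw [polyform, h, Finset.sum_const, nsmul_eq_mul, mul_assoc]

lemma rpow_div_sub_eq :
    (n : ℝ) ^ ((r : ℝ) / α - r) = (((n : ℝ) ^ (1 - 1 / α)) ^ r)⁻¹ := by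
  rw [← Real.rpow_mul_natCast (Nat.cast_nonneg n), ← Real.rpow_neg (Nat.cast_nonneg n)]
  congr 1
  ring

lemma lamP_mul_le (hr : 1 ≤ r) {k : ℕ} (hrk : r ≤ k + 1) (hα : 1 ≤ α) (hn : 0 < n)
    {P : ∀ n, Set (HGraph r n)} (hP : Hereditary P) (hne : (P n).Nonempty) :
    lamP α P n * (n : ℝ) ^ ((r : ℝ) / α - r) ≤
      (exP P (k + 1) : ℝ) / ((k + 1).choose r : ℝ) +
        ((k : ℝ) + 1) ^ 2 * (n : ℝ) ^ (-(1 - 1 / α)) := by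
  have hn' : (0 : ℝ) < n := Nat.cast_pos.2 hn
  obtain ⟨G₀, hG₀⟩ := hne
  have h : lamP α P n ≤ _ := csSup_le ⟨_, G₀, hG₀, rfl⟩ (by
    rintro _ ⟨G, hG, rfl⟩
    exact lam_le hr hrk hα hn hP hG)
  rw [rpow_div_sub_eq, Real.rpow_neg hn'.le]
  have hs : 0 < (n : ℝ) ^ (1 - 1 / α) := Real.rpow_pos_of_pos hn' _
  set s := (n : ℝ) ^ (1 - 1 / α)
  rw [← div_eq_mul_inv, div_le_iff₀ (pow_pos hs r)]
  refine h.trans_eq ?_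
  have hpow : s ^ r = s * s ^ (r - 1) := by rw [← pow_succ']; congr 1; omega
  rw [add_mul, add_right_inj, hpow]
  field_simp

lemma le_lamP_mul (hr : 1 ≤ r) (hα : 1 ≤ α) (hn : r ≤ n) {P : ∀ n, Set (HGraph r n)}
    (hP : Hereditary P) (hne : (P n).Nonempty) :
    (exP P n : ℝ) * (r.factorial / (n : ℝ) ^ r) ≤ lamP α P n * (n : ℝ) ^ ((r : ℝ) / α - r) := by
  have hn0 : 0 < n := by omega
  have hn' : (0 : ℝ) < n := Nat.cast_pos.2 hn0
  obtain ⟨G, hG, hGe⟩ := exists_card_edges_eq_exP hne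
  have hbdd : BddAbove {y : ℝ | ∃ G ∈ P n, y = lam α G} := by
    refine ⟨(exP P (n + 1) : ℝ) / ((n + 1).choose r : ℝ) * ((n : ℝ) ^ (1 - 1 / α)) ^ r +
      ((n : ℝ) + 1) ^ 2 * ((n : ℝ) ^ (1 - 1 / α)) ^ (r - 1), ?_⟩
    rintro _ ⟨G, hG, rfl⟩
    exact lam_le hr (by omega) hα hn0 hP hG
  have h : lam α G ≤ lamP α P n := le_csSup hbdd ⟨G, hG, rfl⟩
  have h' := (factorial_mul_card_edges_le_lam (by linarith) hn0 G).trans h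
  rw [hGe] at h'
  refine le_trans (le_of_eq ?_) (mul_le_mul_of_nonneg_right h' (Real.rpow_nonneg hn'.le _))
  have hpow : ((n : ℝ) ^ (-(1 / α))) ^ r * (n : ℝ) ^ ((r : ℝ) / α - r) = ((n : ℝ) ^ r)⁻¹ := by
    rw [← Real.rpow_mul_natCast hn'.le, ← Real.rpow_add hn', ← Real.rpow_natCast,
      ← Real.rpow_neg hn'.le]
    congr 1
    ring
  rw [mul_assoc, hpow]
  ring

end Limits

end HGraph

open HGraph

/-- Theorem 3, the central result: for every hereditary property
`P` of `r`-graphs (containing graphs of every order) and every `α > 1`,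
`λ^(α)(P) = π(P)`: the two limits exist and are equal. -/
theorem stmt13 {r : ℕ} (hr : 2 ≤ r) (P : ∀ n, Set (HGraph r n))
    (hprop : IsProperty P) (hher : Hereditary P) (hne : ∀ n, (P n).Nonempty)
    (α : ℝ) (hα : 1 < α) :
    ∃ L : ℝ,
      Filter.Tendsto (fun n : ℕ => lamP α P n * (n : ℝ) ^ ((r : ℝ) / α - r))
        Filter.atTop (nhds L) ∧
      Filter.Tendsto (fun n : ℕ => (exP P n : ℝ) / (n.choose r : ℝ))
        Filter.atTop (nhds L) := by
  let d : ℕ → ℝ := fun n => (exP P n : ℝ) / (n.choose r : ℝ)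
  let a : ℕ → ℝ := fun n => lamP α P n * (n : ℝ) ^ ((r : ℝ) / α - r)
  let c : ℕ → ℝ := fun n => (n.choose r : ℝ) / ((n : ℝ) ^ r / r.factorial)
  have hc : Filter.Tendsto c Filter.atTop (nhds 1) := by
    refine (Asymptotics.isEquivalent_iff_tendsto_one ?_).1 (isEquivalent_choose r)
    filter_upwards [Filter.eventually_gt_atTop 0] with n hn
    positivity
  have hd0 (n : ℕ) : 0 ≤ d n := by positivity
  let L : ℝ := sInf (d '' Set.Ici r)
  have hbdd : BddBelow (d '' Set.Ici r) := ⟨0, by rintro _ ⟨n, -, rfl⟩; exact hd0 n⟩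
  have hL {n : ℕ} (hn : r ≤ n) : L ≤ d n := csInf_le hbdd ⟨n, hn, rfl⟩
  have hlow {n : ℕ} (hn : r ≤ n) : d n * c n ≤ a n := by
    refine le_trans (le_of_eq ?_) (le_lamP_mul (by omega) hα.le hn hher (hne n))
    have h1 : (n.choose r : ℝ) ≠ 0 := Nat.cast_ne_zero.2 (Nat.choose_pos hn).ne'
    have h2 : (n : ℝ) ≠ 0 := Nat.cast_ne_zero.2 (by omega)
    simp only [d, c]
    field_simp
  have hupper (b : ℝ) (hb : L < b) : ∀ᶠ n in Filter.atTop, a n < b := by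
    obtain ⟨_, ⟨m, hm, rfl⟩, hmb⟩ := exists_lt_of_csInf_lt (Set.nonempty_Ici.image d) hb
    obtain ⟨k, rfl⟩ : ∃ k, m = k + 1 := ⟨m - 1, by have := Set.mem_Ici.1 hm; omega⟩
    have hα' : 0 < 1 - 1 / α := by
      rw [sub_pos, div_lt_one (by linarith)]
      exact hα
    have hlim : Filter.Tendsto
        (fun n : ℕ => d (k + 1) + ((k : ℝ) + 1) ^ 2 * (n : ℝ) ^ (-(1 - 1 / α)))
        Filter.atTop (nhds (d (k + 1))) := by
      simpa using (((tendsto_rpow_neg_atTop hα').comp tendsto_natCast_atTop_atTop).const_mul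
        (((k : ℝ) + 1) ^ 2)).const_add (d (k + 1))
    filter_upwards [hlim.eventually_lt_const hmb, Filter.eventually_gt_atTop 0] with n hn hn0
    exact (lamP_mul_le (by omega) hm hα.le hn0 hher (hne n)).trans_lt hn
  have ha : Filter.Tendsto a Filter.atTop (nhds L) := by
    refine tendsto_order.2 ⟨fun b hb => ?_, hupper⟩
    have hLc : Filter.Tendsto (fun n => L * c n) Filter.atTop (nhds L) := by
      simpa using hc.const_mul L
    filter_upwards [hLc.eventually_const_lt hb, Filter.eventually_ge_atTop r] with n hn hrn
    refine hn.trans_le (le_trans ?_ (hlow hrn))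
    exact mul_le_mul_of_nonneg_right (hL hrn) (by positivity)
  refine ⟨L, ha, ?_⟩
  have hac : Filter.Tendsto (fun n => a n / c n) Filter.atTop (nhds L) := by
    have h := ha.div hc one_ne_zero
    rwa [div_one] at h
  refine tendsto_of_tendsto_of_tendsto_of_le_of_le' tendsto_const_nhds hac ?_ ?_
  · filter_upwards [Filter.eventually_ge_atTop r] with n hn using hL hn
  · filter_upwards [Filter.eventually_ge_atTop r, hc.eventually_const_lt zero_lt_one]
      with n hn hcn
    exact (le_div_iff₀ hcn).2 (hlow hn)
end

section
/- Let α > 1 and let P be a monotone property of 2-graphs that does not contain all 2-graphs. Let s = min{ χ(G) : G ∉ P }, where χ denotes the chromatic number. Then λ^(α)(P) = (s−2)/(s−1). -/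
/-!
Common definitions: `r`-uniform hypergraphs on vertex set `Fin n`, the polyform,
the parameter `λ^(α)`, degrees, properties of `r`-graphs, blow-ups, extremal
numbers and chromatic numbers.
-/

open Finset

open HGraph

open Matrix in
/-- A quadratic polynomial with zero diagonal is affine in each coordinate. -/
lemma quadratic_eq_affine_combination {ι : Type*} [Fintype ι] [DecidableEq ι]
    (B : Matrix ι ι ℝ) (hB : ∀ i, B i i = 0) (b : ι → ℝ) (p : ι → ℝ) (i : ι) :
    p ⬝ᵥ B *ᵥ p + b ⬝ᵥ p =
      (1 - p i) * (Function.update p i 0 ⬝ᵥ B *ᵥ Function.update p i 0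
        + b ⬝ᵥ Function.update p i 0) +
      p i * (Function.update p i 1 ⬝ᵥ B *ᵥ Function.update p i 1
        + b ⬝ᵥ Function.update p i 1) := by
  have key : ∀ t : ℝ, Function.update p i t = Function.update p i 0 + t • Pi.single i 1 := by
    intro t
    ext j
    by_cases h : j = i
    · subst h; simp
    · simp [h]
  set q := Function.update p i 0
  have h1 : (Pi.single i 1 : ι → ℝ) ⬝ᵥ B *ᵥ Pi.single i 1 = 0 := by simp [hB]
  have aff : ∀ t : ℝ, Function.update p i t ⬝ᵥ B *ᵥ Function.update p i t
      + b ⬝ᵥ Function.update p i t = q ⬝ᵥ B *ᵥ q + b ⬝ᵥ q +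
      t * ((Pi.single i 1 : ι → ℝ) ⬝ᵥ B *ᵥ q + q ⬝ᵥ B *ᵥ Pi.single i 1
        + b ⬝ᵥ Pi.single i 1) := by
    intro t
    rw [key t]
    simp only [mulVec_add, add_dotProduct, dotProduct_add, mulVec_smul, smul_dotProduct,
      dotProduct_smul, h1, smul_eq_mul]
    ring
  have hp := aff (p i)
  rw [Function.update_eq_self] at hp
  rw [hp, aff 1]
  ring

open Matrix in
/-- A quadratic polynomial with zero diagonal that is bounded below on the vertices of the unit
cube is bounded below on the whole cube. -/
lemma quadratic_lower_bound_on_cube {ι : Type*} [Fintype ι] [DecidableEq ι]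
    (B : Matrix ι ι ℝ) (hB : ∀ i, B i i = 0) (b : ι → ℝ) (C : ℝ)
    (h : ∀ S : Finset ι, C ≤ (fun i => if i ∈ S then (1 : ℝ) else 0) ⬝ᵥ
      B *ᵥ (fun i => if i ∈ S then (1 : ℝ) else 0)
        + b ⬝ᵥ (fun i => if i ∈ S then (1 : ℝ) else 0))
    (p : ι → ℝ) (hp : ∀ i, 0 ≤ p i ∧ p i ≤ 1) :
    C ≤ p ⬝ᵥ B *ᵥ p + b ⬝ᵥ p := by
  suffices H : ∀ (T : Finset ι) (p : ι → ℝ), (∀ i, 0 ≤ p i ∧ p i ≤ 1) →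
      (∀ i ∉ T, p i = 0 ∨ p i = 1) → C ≤ p ⬝ᵥ B *ᵥ p + b ⬝ᵥ p from
    H Finset.univ p hp (by simp)
  intro T
  induction T using Finset.induction_on with
  | empty =>
    intro p _ h01
    have : p = fun i => if i ∈ Finset.univ.filter (fun i => p i = 1) then (1 : ℝ) else 0 := by
      ext i
      rcases h01 i (by simp) with h | h <;> simp [h]
    rw [this]
    exact h _
  | insert i T _ ih =>
    intro p hp h01
    rw [quadratic_eq_affine_combination B hB b p i]
    have hT : ∀ t : ℝ, (t = 0 ∨ t = 1) → C ≤ Function.update p i t ⬝ᵥ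
        B *ᵥ Function.update p i t + b ⬝ᵥ Function.update p i t := by
      intro t ht
      apply ih
      · intro j
        by_cases hj : j = i
        · subst hj
          rcases ht with rfl | rfl <;> simp
        · simpa [hj] using hp j
      · intro j hj
        by_cases hji : j = i
        · subst hji
          simpa using ht
        · simpa [hji] using h01 j (by simp [hji, hj])
    have h0 := hT 0 (Or.inl rfl)
    have h1 := hT 1 (Or.inr rfl)
    nlinarith [mul_le_mul_of_nonneg_left h0 (sub_nonneg.2 (hp i).2),
      mul_le_mul_of_nonneg_left h1 (hp i).1]

open Classical in
/-- If all large induced subgraphs have small minimum degree, then all induced subgraphs have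
few edges. -/
lemma sum_adj_le_of_minDegree_lt {n : ℕ} (A : SimpleGraph (Fin n)) (c : ℝ) (hc : 0 ≤ c) (N : ℕ)
    (hN : 1 ≤ N)
    (h : ∀ m ≥ N, ∀ f : Fin m ↪ Fin n, ((A.comap f).minDegree : ℝ) < c * m)
    (S : Finset (Fin n)) :
    ∑ i ∈ S, ∑ j ∈ S, (if A.Adj i j then (1 : ℝ) else 0) ≤
      c * ((S.card : ℝ) ^ 2 + S.card) + (N : ℝ) ^ 2 := by
  induction S using Finset.strongInduction with
  | H S ih =>
    by_cases hS : S.card < N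
    · have h1 : ∑ i ∈ S, ∑ j ∈ S, (if A.Adj i j then (1 : ℝ) else 0) ≤
          ∑ i ∈ S, ∑ j ∈ S, (1 : ℝ) := by
        gcongr with i _ j _
        split_ifs <;> norm_num
      have h2 : (S.card : ℝ) ≤ N := by exact_mod_cast hS.le
      simp only [Finset.sum_const, nsmul_eq_mul, mul_one] at h1
      have : 0 ≤ c * ((S.card : ℝ) ^ 2 + S.card) := by positivity
      nlinarith [(Nat.cast_nonneg S.card : (0 : ℝ) ≤ S.card)]
    · push Not at hS
      let f : Fin S.card ↪ Fin n := (S.orderEmbOfFin rfl).toEmbedding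
      have hf : Finset.univ.map f = S := by simp [f]
      have hdeg := h _ hS f
      have : Nonempty (Fin S.card) := ⟨⟨0, by omega⟩⟩
      obtain ⟨v, hv⟩ := (A.comap f).exists_minimal_degree_vertex
      rw [hv] at hdeg
      have hd : ((A.comap f).degree v : ℝ) =
          ∑ j ∈ S, (if A.Adj (f v) j then (1 : ℝ) else 0) := by
        have hsum_map := Finset.sum_map Finset.univ f
          (fun j => if A.Adj (f v) j then (1 : ℝ) else 0)
        rw [hf] at hsum_map
        rw [hsum_map, Finset.sum_boole, ← SimpleGraph.card_neighborFinset_eq_degree]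
        congr 2
        ext w
        simp
      have hvS : f v ∈ S := by simp [f]
      have ih' := ih (S.erase (f v)) (Finset.erase_ssubset hvS)
      have hcard : ((S.erase (f v)).card : ℝ) = S.card - 1 := by
        rw [Finset.card_erase_of_mem hvS]
        push_cast [hN.trans hS]
        ring
      rw [hcard] at ih'
      rw [hd] at hdeg
      set w := f v
      have hsum : ∀ g : Fin n → ℝ, ∑ i ∈ S, g i = g w + ∑ i ∈ S.erase w, g i :=
        fun g => (Finset.add_sum_erase S g hvS).symm
      have e1 : ∑ i ∈ S, ∑ j ∈ S, (if A.Adj i j then (1 : ℝ) else 0) =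
          2 * ∑ j ∈ S, (if A.Adj w j then (1 : ℝ) else 0) +
          ∑ i ∈ S.erase w, ∑ j ∈ S.erase w, (if A.Adj i j then (1 : ℝ) else 0) := by
        simp only [hsum, Finset.sum_add_distrib, SimpleGraph.irrefl, if_false, A.adj_comm _ w]
        ring
      rw [e1]
      nlinarith

open Matrix Classical in
/-- An edge bound for all induced subgraphs passes to fractional vertex weights. -/
lemma quadraticForm_le_of_sum_adj_le {n : ℕ} (A : SimpleGraph (Fin n)) (c C : ℝ) (hc : 0 ≤ c)
    (h : ∀ S : Finset (Fin n), ∑ i ∈ S, ∑ j ∈ S, (if A.Adj i j then (1 : ℝ) else 0) ≤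
      c * ((S.card : ℝ) ^ 2 + S.card) + C)
    (p : Fin n → ℝ) (hp : ∀ i, 0 ≤ p i ∧ p i ≤ 1) :
    ∑ i, ∑ j, (if A.Adj i j then p i * p j else 0) ≤
      c * ((∑ i, p i) ^ 2 + 2 * n) + C := by
  let B : Matrix (Fin n) (Fin n) ℝ := fun i j =>
    c * (if i = j then 0 else 1) - (if A.Adj i j then (1 : ℝ) else 0)
  have hexp : ∀ q : Fin n → ℝ, q ⬝ᵥ B *ᵥ q + (fun _ => 2 * c) ⬝ᵥ q =
      c * ((∑ i, q i) ^ 2 - ∑ i, q i ^ 2 + 2 * ∑ i, q i) -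
      ∑ i, ∑ j, (if A.Adj i j then q i * q j else 0) := by
    intro q
    have h1 : ∑ i, ∑ j, (if i = j then 0 else q i * q j) = (∑ i, q i) ^ 2 - ∑ i, q i ^ 2 := by
      rw [sq, Finset.sum_mul_sum, ← Finset.sum_sub_distrib]
      refine Finset.sum_congr rfl fun i _ => ?_
      have hi : q i ^ 2 = ∑ j, (if i = j then q j ^ 2 else 0) := by simp
      rw [eq_sub_iff_add_eq, hi, ← Finset.sum_add_distrib]
      refine Finset.sum_congr rfl fun j _ => ?_
      split_ifs with hij
      · subst hij; ring
      · ring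
    rw [mul_add, ← h1]
    simp only [dotProduct, mulVec, B, Finset.mul_sum]
    rw [add_sub_right_comm, ← Finset.sum_sub_distrib]
    congr 1
    · refine Finset.sum_congr rfl fun i _ => ?_
      rw [← Finset.sum_sub_distrib]
      refine Finset.sum_congr rfl fun j _ => ?_
      split_ifs <;> ring
    · refine Finset.sum_congr rfl fun i _ => ?_
      ring
  have key := quadratic_lower_bound_on_cube B (by simp [B]) (fun _ => 2 * c) (-C) (by
    intro S
    rw [hexp]
    have hS := h S
    have h2 : ∑ i, ∑ j, (if A.Adj i j then (if i ∈ S then (1 : ℝ) else 0) *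
        (if j ∈ S then (1 : ℝ) else 0) else 0) =
        ∑ i ∈ S, ∑ j ∈ S, (if A.Adj i j then (1 : ℝ) else 0) := by
      have hin : ∀ T : Finset (Fin n), ∀ g : Fin n → ℝ,
          ∑ i ∈ T, g i = ∑ i, if i ∈ T then g i else 0 := by simp
      rw [hin S]
      refine Finset.sum_congr rfl fun i _ => ?_
      by_cases hi : i ∈ S
      · simp only [if_pos hi]
        rw [hin S]
        refine Finset.sum_congr rfl fun j _ => ?_
        split_ifs <;> simp
      · simp [hi]
    have h3 : ∑ i, (if i ∈ S then (1 : ℝ) else 0) = S.card := by simp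
    have h4 : ∑ i, (if i ∈ S then (1 : ℝ) else 0) ^ 2 = S.card := by simp
    rw [h2, h3, h4]
    linarith) p hp
  rw [hexp] at key
  have h1 : ∑ i, p i ≤ n := by
    calc ∑ i, p i ≤ ∑ _i : Fin n, (1 : ℝ) := Finset.sum_le_sum fun i _ => (hp i).2
      _ = n := by simp
  have h2 : 0 ≤ ∑ i, p i ^ 2 := by positivity
  nlinarith

lemma power_mean_sum_le {ι : Type*} (s : Finset ι) {α : ℝ} (hα : 1 < α) (y : ι → ℝ)
    (hy : ∀ i, 0 ≤ y i) (h : ∑ i ∈ s, y i ^ α = s.card) : ∑ i ∈ s, y i ≤ s.card := by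
  have h1 : ∑ i ∈ s, (1 + α * (y i - 1)) ≤ ∑ i ∈ s, y i ^ α := by
    refine Finset.sum_le_sum fun i _ => ?_
    have := one_add_mul_self_le_rpow_one_add (s := y i - 1) (by linarith [hy i]) hα.le
    simpa using this
  rw [h, Finset.sum_add_distrib, ← Finset.mul_sum, Finset.sum_sub_distrib] at h1
  simp only [Finset.sum_const, nsmul_eq_mul, mul_one] at h1
  nlinarith

lemma sum_truncation_error_le {ι : Type*} (s : Finset ι) {α : ℝ} (hα : 1 < α) (y : ι → ℝ)
    (hy : ∀ i, 0 ≤ y i) (h : ∑ i ∈ s, y i ^ α = s.card) {M : ℝ} (hM : 0 < M) :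
    ∑ i ∈ s, (y i - min (y i) M) ≤ M ^ (1 - α) * s.card := by
  rw [← h, Finset.mul_sum]
  refine Finset.sum_le_sum fun i _ => ?_
  rcases le_total (y i) M with hi | hi
  · rw [min_eq_left hi, sub_self]
    have := hy i
    positivity
  · rw [min_eq_right hi]
    have hyi : 0 < y i := hM.trans_le hi
    calc y i - M ≤ y i := by linarith
      _ = y i ^ (1 - α) * y i ^ α := by rw [← Real.rpow_add hyi]; simp
      _ ≤ M ^ (1 - α) * y i ^ α := by
        gcongr ?_ * _
        exact Real.rpow_le_rpow_of_nonpos hM hi (by linarith)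

open Classical in
/-- A combinatorial edge bound for all induced subgraphs bounds the quadratic form of a graph on
the unit sphere of `ℓ^α`. -/
lemma quadraticForm_mul_rpow_le {n : ℕ} (hn : 0 < n) (A : SimpleGraph (Fin n)) (c C : ℝ)
    (hc : 0 ≤ c)
    (h : ∀ S : Finset (Fin n), ∑ i ∈ S, ∑ j ∈ S, (if A.Adj i j then (1 : ℝ) else 0) ≤
      c * ((S.card : ℝ) ^ 2 + S.card) + C)
    {α : ℝ} (hα : 1 < α) (x : Fin n → ℝ) (hx : ∑ i, |x i| ^ α = 1) {M : ℝ} (hM : 0 < M) :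
    (∑ i, ∑ j, if A.Adj i j then x i * x j else 0) * (n : ℝ) ^ (2 / α - 2) ≤
      c + 2 * M ^ (1 - α) + M ^ 2 * (c * (2 * n) + C) / (n : ℝ) ^ 2 := by
  have hn' : (0 : ℝ) < n := by exact_mod_cast hn
  set y : Fin n → ℝ := fun i => (n : ℝ) ^ (1 / α) * |x i| with hy
  have hy0 : ∀ i, 0 ≤ y i := fun i => by positivity
  have hysum : ∑ i, y i ^ α = (Finset.univ : Finset (Fin n)).card := by
    have : ∀ i, y i ^ α = n * |x i| ^ α := by
      intro i
      rw [hy, Real.mul_rpow (by positivity) (abs_nonneg _), ← Real.rpow_mul hn'.le,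
        one_div_mul_cancel (by linarith), Real.rpow_one]
    simp [this, ← Finset.mul_sum, hx]
  have hmean := power_mean_sum_le Finset.univ hα y hy0 hysum
  have htrunc := sum_truncation_error_le Finset.univ hα y hy0 hysum hM
  set z : Fin n → ℝ := fun i => min (y i) M with hz
  have hz0 : ∀ i, 0 ≤ z i := fun i => le_min (hy0 i) hM.le
  have hzy : ∀ i, z i ≤ y i := fun i => min_le_left _ _
  have hzM : ∀ i, z i ≤ M := fun i => min_le_right _ _
  simp only [Finset.card_univ, Fintype.card_fin] at hmean htrunc
  have hzbound : ∑ i, ∑ j, (if A.Adj i j then z i * z j else 0) ≤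
      c * (n : ℝ) ^ 2 + M ^ 2 * (c * (2 * n) + C) := by
    have key := quadraticForm_le_of_sum_adj_le A c C hc h (fun i => z i / M)
      (fun i => ⟨div_nonneg (hz0 i) hM.le, (div_le_one hM).2 (hzM i)⟩)
    have e1 : ∑ i, ∑ j, (if A.Adj i j then z i * z j else 0) =
        M ^ 2 * ∑ i, ∑ j, (if A.Adj i j then z i / M * (z j / M) else 0) := by
      simp only [Finset.mul_sum]
      refine Finset.sum_congr rfl fun i _ => Finset.sum_congr rfl fun j _ => ?_
      split_ifs
      · field_simp
      · ring
    rw [e1]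
    refine (mul_le_mul_of_nonneg_left key (sq_nonneg M)).trans ?_
    rw [← Finset.sum_div]
    have e2 : M ^ 2 * (c * (((∑ i, z i) / M) ^ 2 + 2 * n) + C) =
        c * (∑ i, z i) ^ 2 + M ^ 2 * (c * (2 * n) + C) := by
      field_simp
      ring
    rw [e2]
    have : ∑ i, z i ≤ n := (Finset.sum_le_sum fun i _ => hzy i).trans hmean
    have h0 : 0 ≤ ∑ i, z i := Finset.sum_nonneg fun i _ => hz0 i
    gcongr
  have hyz : ∑ i, ∑ j, (if A.Adj i j then y i * y j else 0) ≤
      ∑ i, ∑ j, (if A.Adj i j then z i * z j else 0) +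
        2 * ((∑ i, (y i - z i)) * ∑ i, y i) := by
    have e : 2 * ((∑ i, (y i - z i)) * ∑ i, y i) =
        ∑ i, ∑ j, ((y i - z i) * y j + y i * (y j - z j)) := by
      simp only [Finset.sum_add_distrib, ← Finset.sum_mul_sum]
      ring
    rw [e, ← Finset.sum_add_distrib]
    refine Finset.sum_le_sum fun i _ => ?_
    rw [← Finset.sum_add_distrib]
    refine Finset.sum_le_sum fun j _ => ?_
    have h1 := mul_nonneg (sub_nonneg.2 (hzy i)) (hy0 j)
    have h2 := mul_nonneg (sub_nonneg.2 (hzy j)) (hy0 i)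
    have h3 := mul_nonneg (sub_nonneg.2 (hzy j)) (sub_nonneg.2 (hzy i))
    split_ifs <;> nlinarith
  have hxy : (∑ i, ∑ j, if A.Adj i j then x i * x j else 0) * (n : ℝ) ^ (2 / α - 2) ≤
      (∑ i, ∑ j, if A.Adj i j then y i * y j else 0) / (n : ℝ) ^ 2 := by
    have e : (n : ℝ) ^ (2 / α - 2) = ((n : ℝ) ^ (1 / α)) ^ 2 / (n : ℝ) ^ 2 := by
      rw [Real.rpow_sub hn', ← Real.rpow_natCast ((n : ℝ) ^ (1 / α)), ← Real.rpow_mul hn'.le]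
      norm_num
      ring_nf
    rw [e, ← mul_div_assoc]
    gcongr
    simp only [Finset.sum_mul]
    gcongr with i _ j _
    split_ifs
    · have : x i * x j ≤ |x i| * |x j| := by rw [← abs_mul]; exact le_abs_self _
      calc x i * x j * ((n : ℝ) ^ (1 / α)) ^ 2
          ≤ |x i| * |x j| * ((n : ℝ) ^ (1 / α)) ^ 2 := by gcongr
        _ = y i * y j := by simp only [hy]; ring
    · simp
  refine hxy.trans ?_
  have hprod : (∑ i, (y i - z i)) * ∑ i, y i ≤ M ^ (1 - α) * n * n := by
    have h0 : 0 ≤ ∑ i, y i := Finset.sum_nonneg fun i _ => hy0 i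
    gcongr
  rw [div_le_iff₀ (by positivity)]
  have e : (c + 2 * M ^ (1 - α) + M ^ 2 * (c * (2 * n) + C) / (n : ℝ) ^ 2) * (n : ℝ) ^ 2 =
      c * (n : ℝ) ^ 2 + M ^ 2 * (c * (2 * n) + C) + 2 * (M ^ (1 - α) * n * n) := by
    field_simp
    ring
  rw [e]
  linarith

namespace HGraph

/-- The simple graph underlying a `2`-graph. -/
def toSimpleGraph {n : ℕ} (G : HGraph 2 n) : SimpleGraph (Fin n) where
  Adj i j := ({i, j} : Finset (Fin n)) ∈ G.edges
  symm := ⟨fun i j h => by rwa [Finset.pair_comm]⟩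
  loopless := ⟨fun i h => by simpa using G.uniform _ h⟩

lemma toSimpleGraph_adj {n : ℕ} (G : HGraph 2 n) (i j : Fin n) :
    G.toSimpleGraph.Adj i j ↔ ({i, j} : Finset (Fin n)) ∈ G.edges := Iff.rfl

open Classical in
lemma polyform_eq_sum_adj {n : ℕ} (G : HGraph 2 n) (x : Fin n → ℝ) :
    G.polyform x = ∑ i, ∑ j, if G.toSimpleGraph.Adj i j then x i * x j else 0 := by
  rw [← Fintype.sum_prod_type' (f := fun i j => if G.toSimpleGraph.Adj i j then x i * x j else 0),
    ← Finset.sum_filter, ← Finset.sum_fiberwise_of_maps_to (t := G.edges)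
      (g := fun q : Fin n × Fin n => ({q.1, q.2} : Finset (Fin n)))
      (show ∀ q ∈ Finset.univ.filter (fun q : Fin n × Fin n => G.toSimpleGraph.Adj q.1 q.2),
        ({q.1, q.2} : Finset (Fin n)) ∈ G.edges from fun q hq => (Finset.mem_filter.1 hq).2),
    polyform, Finset.mul_sum]
  refine Finset.sum_congr rfl fun e he => ?_
  obtain ⟨a, b, hab, rfl⟩ := Finset.card_eq_two.1 (G.uniform e he)
  have : (Finset.univ.filter fun q : Fin n × Fin n => G.toSimpleGraph.Adj q.1 q.2).filter
      (fun q => ({q.1, q.2} : Finset (Fin n)) = {a, b}) = {(a, b), (b, a)} := by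
    ext ⟨i, j⟩
    simp only [Finset.mem_filter, Finset.mem_univ, true_and, toSimpleGraph_adj, Finset.mem_insert,
      Finset.mem_singleton, Prod.mk.injEq, ← Finset.coe_inj, Finset.coe_pair,
      Set.pair_eq_pair_iff]
    constructor
    · exact fun h => h.2
    · rintro (⟨rfl, rfl⟩ | ⟨rfl, rfl⟩)
      · exact ⟨he, Or.inl ⟨rfl, rfl⟩⟩
      · exact ⟨by rwa [Finset.pair_comm], Or.inr ⟨rfl, rfl⟩⟩
  rw [this, Finset.sum_pair (by simp [hab]), Finset.prod_pair hab]
  norm_num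
  ring

instance {r n : ℕ} : Finite (HGraph r n) :=
  Finite.of_injective HGraph.edges fun G H h => by
    cases G; cases H; simpa using h

lemma polyform_le_sq {n : ℕ} (G : HGraph 2 n) {α : ℝ} (hα : 0 < α) (x : Fin n → ℝ)
    (hx : ∑ i, |x i| ^ α = 1) : G.polyform x ≤ (n : ℝ) ^ 2 := by
  classical
  have h1 : ∀ i, |x i| ≤ 1 := by
    intro i
    have : |x i| ^ α ≤ 1 := hx ▸ Finset.single_le_sum (f := fun i => |x i| ^ α)
      (fun j _ => by positivity) (Finset.mem_univ i)
    by_contra hlt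
    push Not at hlt
    exact absurd this (not_le.2 (Real.one_lt_rpow hlt hα))
  rw [polyform_eq_sum_adj]
  calc _ ≤ ∑ _i : Fin n, ∑ _j : Fin n, (1 : ℝ) := by
        gcongr with i _ j _
        split_ifs
        · calc x i * x j ≤ |x i| * |x j| := by rw [← abs_mul]; exact le_abs_self _
            _ ≤ 1 * 1 := mul_le_mul (h1 i) (h1 j) (abs_nonneg _) zero_le_one
            _ = 1 := one_mul 1
        · norm_num
    _ = (n : ℝ) ^ 2 := by simp [sq]

lemma polyform_le_lam {n : ℕ} (G : HGraph 2 n) {α : ℝ} (hα : 0 < α) (x : Fin n → ℝ)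
    (hx : ∑ i, |x i| ^ α = 1) : G.polyform x ≤ lam α G :=
  le_csSup ⟨(n : ℝ) ^ 2, by rintro _ ⟨y, hy, rfl⟩; exact G.polyform_le_sq hα y hy⟩ ⟨x, hx, rfl⟩

lemma lam_le_lamP {r n : ℕ} {α : ℝ} {P : ∀ n, Set (HGraph r n)} {G : HGraph r n} (hG : G ∈ P n) :
    lam α G ≤ lamP α P n := by
  refine le_csSup ?_ ⟨G, hG, rfl⟩
  refine ((Set.toFinite (P n)).image (lam α)).bddAbove.mono ?_
  rintro _ ⟨H, hH, rfl⟩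
  exact ⟨H, hH, rfl⟩

lemma colorable_chrom {n : ℕ} (G : HGraph 2 n) : G.toSimpleGraph.Colorable (chrom G) := by
  have hne : {k : ℕ | ∃ c : Fin n → Fin k, ∀ e ∈ G.edges,
      ¬ ∀ u ∈ e, ∀ w ∈ e, c u = c w}.Nonempty := by
    refine ⟨n, id, fun e he h => ?_⟩
    have := Finset.card_le_one.2 h
    have := G.uniform e he
    omega
  obtain ⟨c, hc⟩ := Nat.sInf_mem hne
  refine ⟨SimpleGraph.Coloring.mk c fun {u v} huv h => hc _ huv ?_⟩
  simp [h]

lemma chrom_le_of_colorable {n k : ℕ} {G : HGraph 2 n} (h : G.toSimpleGraph.Colorable k) :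
    chrom G ≤ k := by
  obtain ⟨c⟩ := h
  refine Nat.sInf_le ⟨c, fun e he hmono => ?_⟩
  obtain ⟨a, b, hab, rfl⟩ := Finset.card_eq_two.1 (G.uniform e he)
  exact c.valid (show G.toSimpleGraph.Adj a b from he) (hmono a (by simp) b (by simp))

lemma mem_of_isContained {P : ∀ n, Set (HGraph 2 n)} (hmon : MonotoneProp P) {n m : ℕ}
    {G : HGraph 2 n} (hG : G ∈ P n) {H : HGraph 2 m}
    (h : H.toSimpleGraph.IsContained G.toSimpleGraph) : H ∈ P m := by
  obtain ⟨f⟩ := h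
  refine hmon n m f.toEmbedding G hG H fun e he => ?_
  obtain ⟨a, b, hab, rfl⟩ := Finset.card_eq_two.1 (H.uniform e he)
  have := f.toHom.map_adj (show H.toSimpleGraph.Adj a b from he)
  rw [Finset.map_insert, Finset.map_singleton]
  exact this

open Classical in
/-- The Turán graph as a `2`-graph. -/
noncomputable def turan (n r : ℕ) : HGraph 2 n where
  edges := Finset.univ.filter fun e => ∃ i j : Fin n, (i : ℕ) % r ≠ j % r ∧ e = {i, j}
  uniform := by
    intro e he
    obtain ⟨i, j, hij, rfl⟩ := (Finset.mem_filter.1 he).2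
    exact Finset.card_pair fun h => hij (by rw [h])

lemma turan_adj {n r : ℕ} (i j : Fin n) :
    (turan n r).toSimpleGraph.Adj i j ↔ (i : ℕ) % r ≠ j % r := by
  simp only [toSimpleGraph_adj, turan, Finset.mem_filter, Finset.mem_univ, true_and]
  constructor
  · rintro ⟨a, b, hab, h⟩
    rw [← Finset.coe_inj, Finset.coe_pair, Finset.coe_pair, Set.pair_eq_pair_iff] at h
    rcases h with ⟨rfl, rfl⟩ | ⟨rfl, rfl⟩
    · exact hab
    · exact hab.symm
  · exact fun h => ⟨i, j, h, rfl⟩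

lemma turan_colorable {n r : ℕ} (hr : 0 < r) : (turan n r).toSimpleGraph.Colorable r :=
  ⟨SimpleGraph.Coloring.mk (fun i => (⟨(i : ℕ) % r, Nat.mod_lt _ hr⟩ : Fin r))
    fun {u v} huv h => (turan_adj u v).1 huv (by simpa using h)⟩

lemma card_filter_mod_eq_le (n r a : ℕ) :
    (Finset.univ.filter fun j : Fin n => a % r = (j : ℕ) % r).card ≤ n / r + 1 := by
  rw [← Finset.card_range (n / r + 1)]
  refine Finset.card_le_card_of_injOn (fun j => (j : ℕ) / r) ?_ ?_
  · intro j _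
    simp only [Finset.coe_range, Set.mem_Iio]
    exact Nat.lt_succ_of_le (Nat.div_le_div_right j.2.le)
  · intro j hj k hk hjk
    have hj' := (Finset.mem_filter.1 (Finset.mem_coe.1 hj)).2
    have hk' := (Finset.mem_filter.1 (Finset.mem_coe.1 hk)).2
    ext
    rw [← Nat.div_add_mod (j : ℕ) r, ← Nat.div_add_mod (k : ℕ) r, ← hj', ← hk']
    exact congrArg (r * · + a % r) hjk

lemma le_lam_turan {n r : ℕ} (hn : 0 < n) {α : ℝ} (hα : 0 < α) :
    1 - 1 / (r : ℝ) - 1 / n ≤ lam α (turan n r) * (n : ℝ) ^ (2 / α - 2) := by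
  classical
  have hn' : (0 : ℝ) < n := by exact_mod_cast hn
  have hx : ∑ _i : Fin n, |(n : ℝ) ^ (-(1 / α))| ^ α = 1 := by
    rw [abs_of_nonneg (by positivity), ← Real.rpow_mul hn'.le, neg_mul,
      one_div_mul_cancel hα.ne', Real.rpow_neg_one]
    simp [hn'.ne']
  have hle := (turan n r).polyform_le_lam hα _ hx
  have hcount : ((n : ℝ) ^ 2 - n * (n / r + 1)) * ((n : ℝ) ^ (-(1 / α))) ^ 2 ≤
      (turan n r).polyform fun _ => (n : ℝ) ^ (-(1 / α)) := by
    rw [polyform_eq_sum_adj]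
    have hrow : ∀ i : Fin n, ((n : ℝ) - (n / r + 1)) * ((n : ℝ) ^ (-(1 / α))) ^ 2 ≤
        ∑ j, if (turan n r).toSimpleGraph.Adj i j then
          (n : ℝ) ^ (-(1 / α)) * (n : ℝ) ^ (-(1 / α)) else 0 := by
      intro i
      rw [← Finset.sum_filter, Finset.sum_const, nsmul_eq_mul, ← sq]
      gcongr
      have h1 := Finset.card_filter_add_card_filter_not (s := (Finset.univ : Finset (Fin n)))
        (fun j => (i : ℕ) % r = (j : ℕ) % r)
      have h2 : ((n / r : ℕ) : ℝ) ≤ n / r := Nat.cast_div_le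
      have h3 : (((Finset.univ.filter fun j : Fin n => (i : ℕ) % r = (j : ℕ) % r).card : ℕ) : ℝ)
          ≤ ((n / r + 1 : ℕ) : ℝ) := by exact_mod_cast card_filter_mod_eq_le n r i
      simp only [Finset.card_univ, Fintype.card_fin] at h1
      have h4 : ((Finset.univ.filter fun j : Fin n => (i : ℕ) % r = (j : ℕ) % r).card : ℝ) +
        ((Finset.univ.filter fun j : Fin n => ¬ (i : ℕ) % r = (j : ℕ) % r).card : ℝ) = n := by
        exact_mod_cast h1
      simp only [turan_adj]
      push_cast at h3
      linarith
    refine le_trans (le_of_eq ?_) (Finset.sum_le_sum fun i _ => hrow i)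
    simp
    ring
  have e : ((n : ℝ) ^ (-(1 / α))) ^ 2 * (n : ℝ) ^ (2 / α - 2) = 1 / (n : ℝ) ^ 2 := by
    rw [← Real.rpow_natCast ((n : ℝ) ^ (-(1 / α))), ← Real.rpow_mul hn'.le,
      ← Real.rpow_add hn', ← Real.rpow_natCast (n : ℝ) 2, one_div ((n : ℝ) ^ _), ← Real.rpow_neg hn'.le]
    congr 1
    push_cast
    ring
  calc 1 - 1 / (r : ℝ) - 1 / n
      = ((n : ℝ) ^ 2 - n * (n / r + 1)) * (1 / (n : ℝ) ^ 2) := by field_simp; ring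
    _ = ((n : ℝ) ^ 2 - n * (n / r + 1)) * ((n : ℝ) ^ (-(1 / α))) ^ 2 *
          (n : ℝ) ^ (2 / α - 2) := by rw [mul_assoc, e]
    _ ≤ _ := by gcongr; exact hcount.trans hle

/-- Edge bound for the members of a monotone property missing an `(r + 1)`-colorable graph. -/
lemma exists_sum_adj_le {P : ∀ n, Set (HGraph 2 n)} (hmon : MonotoneProp P) {h r : ℕ}
    {F : HGraph 2 h} (hF : F ∉ P h) (hcol : F.toSimpleGraph.Colorable (r + 1))
    {ε : ℝ} (hε : 0 < ε) (hc : 0 ≤ 1 - 1 / (r : ℝ)) :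
    ∃ C : ℝ, ∀ n, ∀ G ∈ P n, ∀ S : Finset (Fin n), open Classical in
      ∑ i ∈ S, ∑ j ∈ S, (if G.toSimpleGraph.Adj i j then (1 : ℝ) else 0) ≤
        (1 - 1 / (r : ℝ) + ε) * ((S.card : ℝ) ^ 2 + S.card) + C := by
  classical
  obtain ⟨N, hN⟩ := Filter.eventually_atTop.1
    (SimpleGraph.eventually_completeEquipartiteGraph_isContained_of_minDegree hε r h)
  refine ⟨((N + 1 : ℕ) : ℝ) ^ 2, fun n G hG S => ?_⟩
  refine sum_adj_le_of_minDegree_lt _ _ (by linarith) (N + 1) (by omega) (fun m hm f => ?_) S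
  by_contra hlt
  push Not at hlt
  obtain ⟨K⟩ := hN m (by omega) hlt
  obtain ⟨c⟩ := hcol
  obtain ⟨K'⟩ := SimpleGraph.isContained_completeEquipartiteGraph_of_colorable c h
    (fun a => (Fintype.card_subtype_le _).trans (by simp))
  exact hF (mem_of_isContained hmon hG
    ⟨((SimpleGraph.Embedding.comap f G.toSimpleGraph).toCopy.comp K).comp K'⟩)

lemma eventually_lamP_mul_le {P : ∀ n, Set (HGraph 2 n)} (hmon : MonotoneProp P) {h r : ℕ}
    {F : HGraph 2 h} (hF : F ∉ P h) (hcol : F.toSimpleGraph.Colorable (r + 1))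
    (hc : 0 ≤ 1 - 1 / (r : ℝ)) {α : ℝ} (hα : 1 < α) {ε : ℝ} (hε : 0 < ε) :
    ∀ᶠ n : ℕ in Filter.atTop, lamP α P n * (n : ℝ) ^ (2 / α - 2) < 1 - 1 / (r : ℝ) + ε := by
  obtain ⟨C, hC⟩ := exists_sum_adj_le hmon hF hcol (ε := ε / 4) (by positivity) hc
  obtain ⟨M, hMε, hM⟩ : ∃ M : ℝ, M ^ (1 - α) < ε / 8 ∧ 0 < M := by
    have := tendsto_rpow_neg_atTop (y := α - 1) (by linarith)
    rw [neg_sub] at this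
    exact ((this.eventually_lt_const (show (0 : ℝ) < ε / 8 by positivity)).and
      (Filter.eventually_gt_atTop 0)).exists
  set c := 1 - 1 / (r : ℝ) + ε / 4 with hcdef
  have hc0 : 0 ≤ c := by linarith
  have herr : Filter.Tendsto
      (fun n : ℕ => M ^ 2 * (c * (2 * n) + C) / (n : ℝ) ^ 2) Filter.atTop (nhds 0) := by
    have h1 : Filter.Tendsto (fun n : ℕ => (n : ℝ)⁻¹) Filter.atTop (nhds 0) :=
      tendsto_inv_atTop_nhds_zero_nat
    have h2 := (h1.const_mul (2 * M ^ 2 * c)).add ((h1.mul h1).const_mul (M ^ 2 * C))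
    simp only [mul_zero, add_zero] at h2
    refine h2.congr' ?_
    filter_upwards [Filter.eventually_gt_atTop 0] with n hn
    have : (n : ℝ) ≠ 0 := by exact_mod_cast hn.ne'
    field_simp
  filter_upwards [herr.eventually_lt_const (show (0 : ℝ) < ε / 4 by positivity),
    herr.eventually_const_lt (show -(ε / 4) < (0 : ℝ) by linarith),
    Filter.eventually_gt_atTop 0] with n hn hn2 hn0
  have hn' : (0 : ℝ) < n := by exact_mod_cast hn0
  have hpow : (0 : ℝ) < (n : ℝ) ^ (2 / α - 2) := by positivity
  have hbound : lamP α P n ≤ (1 - 1 / (r : ℝ) + 3 / 4 * ε) / (n : ℝ) ^ (2 / α - 2) := by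
    have hnonneg : 0 ≤ (1 - 1 / (r : ℝ) + 3 / 4 * ε) / (n : ℝ) ^ (2 / α - 2) :=
      div_nonneg (by linarith) hpow.le
    refine Real.sSup_le ?_ hnonneg
    rintro _ ⟨G, hG, rfl⟩
    refine Real.sSup_le ?_ hnonneg
    rintro _ ⟨x, hx, rfl⟩
    rw [le_div_iff₀ hpow, polyform_eq_sum_adj]
    have := quadraticForm_mul_rpow_le hn0 G.toSimpleGraph c C hc0 (hC n G hG) hα x hx hM
    linarith
  rw [le_div_iff₀ hpow] at hbound
  linarith

end HGraph

/-- Theorem on monotone properties of 2-graphs: let `α > 1` and let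
`P` be a monotone property of `2`-graphs, not containing all `2`-graphs. With
`s = min{χ(G) : G ∉ P}`, we have `λ^(α)(P) = (s−2)/(s−1)`. -/
theorem stmt14 (α : ℝ) (hα : 1 < α) (P : ∀ n, Set (HGraph 2 n))
    (hprop : IsProperty P) (hmon : MonotoneProp P) (hne : ∀ n, (P n).Nonempty)
    (hnotall : ∃ n : ℕ, ∃ G : HGraph 2 n, G ∉ P n)
    (s : ℕ) (hs : s = sInf {c : ℕ | ∃ n : ℕ, ∃ G : HGraph 2 n, G ∉ P n ∧ chrom G = c}) :
    ∃ L : ℝ,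
      Filter.Tendsto (fun n : ℕ => lamP α P n * (n : ℝ) ^ ((2 : ℝ) / α - 2))
        Filter.atTop (nhds L) ∧
      L = ((s : ℝ) - 2) / ((s : ℝ) - 1) := by
  classical
  set Bad := {c : ℕ | ∃ n : ℕ, ∃ G : HGraph 2 n, G ∉ P n ∧ chrom G = c} with hBad
  have hmem : s ∈ Bad := by
    obtain ⟨n, G, hG⟩ := hnotall
    exact hs ▸ Nat.sInf_mem ⟨chrom G, n, G, hG, rfl⟩
  obtain ⟨h, F, hF, hFs⟩ := hmem
  have hcol := F.colorable_chrom
  rw [hFs] at hcol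
  have hs2 : 2 ≤ s := by
    by_contra hlt
    obtain ⟨c⟩ := hcol.mono (show s ≤ 1 by omega)
    obtain ⟨G, hG⟩ := hne h
    refine hF (hmon h h (Function.Embedding.refl _) G hG F fun e he => ?_)
    obtain ⟨a, b, hab, rfl⟩ := Finset.card_eq_two.1 (F.uniform e he)
    exact absurd (Subsingleton.elim _ _) (c.valid (show F.toSimpleGraph.Adj a b from he))
  obtain ⟨r, rfl⟩ : ∃ r, s = r + 1 := ⟨s - 1, by omega⟩
  have hr : 0 < r := by omega
  have hr' : (1 : ℝ) ≤ r := by exact_mod_cast hr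
  have hL : (((r + 1 : ℕ) : ℝ) - 2) / (((r + 1 : ℕ) : ℝ) - 1) = 1 - 1 / (r : ℝ) := by
    push_cast
    have : (r : ℝ) + 1 - 1 = r := by ring
    rw [this]
    field_simp
    ring
  have hc : 0 ≤ 1 - 1 / (r : ℝ) := by
    rw [sub_nonneg, div_le_one (by linarith)]
    exact hr'
  have hturan : ∀ n, turan n r ∈ P n := by
    intro n
    by_contra hn
    have h1 : r + 1 ≤ chrom (turan n r) := hs ▸ Nat.sInf_le ⟨n, _, hn, rfl⟩
    have h2 := chrom_le_of_colorable (turan_colorable (n := n) hr)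
    omega
  refine ⟨_, ?_, rfl⟩
  rw [hL, tendsto_order]
  refine ⟨fun a ha => ?_, fun a ha => ?_⟩
  · have h1 : Filter.Tendsto (fun n : ℕ => 1 - 1 / (r : ℝ) - 1 / (n : ℝ)) Filter.atTop
        (nhds (1 - 1 / (r : ℝ))) := by
      simpa using (tendsto_const_nhds (x := 1 - 1 / (r : ℝ))).sub
        (tendsto_one_div_atTop_nhds_zero_nat (𝕜 := ℝ))
    filter_upwards [h1.eventually_const_lt ha, Filter.eventually_gt_atTop 0] with n hn hn0
    refine hn.trans_le ((le_lam_turan hn0 (zero_lt_one.trans hα)).trans ?_)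
    gcongr
    exact lam_le_lamP (hturan n)
  · have := eventually_lamP_mul_le hmon hF hcol hc hα (sub_pos.2 ha)
    filter_upwards [this] with n hn
    linarith
end
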